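/- arXiv:1205.1068 — 9 statements merged into one kernel-verified Lean document; each statement's English description precedes it below -/
import Mathlib

section
/- Let O be a convex subring of the hyperreal field ℝ* with ideal o := {x ∈ ℝ* : x = 0 ∨ x⁻¹ ∉ O}, and let π : O → O/o be the quotient ring map. Then the relation defined by π(x) ≤ π(y) iff (x ≤ y or x − y ∈ o) is well-defined and is a linear order on the residue field O/o, making O/o a linearly ordered field (addition and multiplication are compatible with this order) such that π is order-preserving on O. Moreover O/o is real closed: every element u of O/o with u ≥ 0 is a square in O/o, and every polynomial over O/o of odd degree has a root in O/o. -/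
open Polynomial Filter in
lemma real_odd_root (P : ℝ[X]) (hm : P.Monic) (ho : Odd P.natDegree) :
    ∃ r : ℝ, P.eval r = 0 := by
  have hpos : 0 < P.natDegree := ho.pos
  have h1 : Tendsto (fun x => eval x P) atTop atTop :=
    P.tendsto_atTop_of_leadingCoeff_nonneg (natDegree_pos_iff_degree_pos.1 hpos)
      (by rw [hm.leadingCoeff]; exact zero_le_one)
  have hdeg : (P.comp (-X)).natDegree = P.natDegree := by simp [natDegree_comp]
  have h2 : Tendsto (fun x => eval x (P.comp (-X))) atTop atBot := by
    apply tendsto_atBot_of_leadingCoeff_nonpos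
    · exact natDegree_pos_iff_degree_pos.1 (hdeg ▸ hpos)
    · rw [leadingCoeff_comp (by simp)]
      simp [hm.leadingCoeff, ho.neg_one_pow]
  obtain ⟨a, ha⟩ := (h1.eventually (eventually_ge_atTop 0)).exists
  obtain ⟨b, hb⟩ := (h2.eventually (eventually_le_atBot 0)).exists
  obtain ⟨r, hr⟩ := mem_range_of_exists_le_of_exists_ge (c := (0 : ℝ)) P.continuous
    ⟨-b, by simpa using hb⟩ ⟨a, ha⟩
  exact ⟨r, hr⟩

/-- The quotient map from sequences to hyperreals. -/
noncomputable def seqHom : (ℕ → ℝ) →+* Hyperreal :=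
  Filter.Germ.coeRingHom (Filter.hyperfilter ℕ : Filter ℕ)

lemma seqHom_surj : Function.Surjective seqHom := fun x =>
  Filter.Germ.inductionOn x fun f => ⟨f, rfl⟩

open Polynomial in
lemma hyper_odd_root (P : Hyperreal[X]) (hm : P.Monic) (ho : Odd P.natDegree) :
    ∃ r : Hyperreal, P.eval r = 0 := by
  obtain ⟨Q, hQ, hd, hQm⟩ := lifts_and_natDegree_eq_and_monic (f := seqHom)
    ((lifts_iff_coeff_lifts P).2 fun n => seqHom_surj _) hm
  have : ∀ k, ∃ r : ℝ, (Q.map (Pi.evalRingHom (fun _ : ℕ => ℝ) k)).eval r = 0 := fun k =>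
    real_odd_root _ (hQm.map _) (by rw [hQm.natDegree_map, hd]; exact ho)
  choose r hr using this
  refine ⟨seqHom r, ?_⟩
  rw [← hQ, eval_map, eval₂_at_apply]
  have : Q.eval r = 0 := by
    funext k
    have := hr k
    rw [eval_map] at this
    have h := eval₂_at_apply (p := Q) (Pi.evalRingHom (fun _ : ℕ => ℝ) k) r
    exact h.symm.trans this
  rw [this, map_zero]

lemma hyper_sqrt (x : Hyperreal) (hx : 0 ≤ x) : ∃ s : Hyperreal, s * s = x := by
  obtain ⟨f, rfl⟩ := seqHom_surj x
  refine ⟨seqHom fun n => Real.sqrt (f n), ?_⟩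
  have h : ∀ᶠ n in (Filter.hyperfilter ℕ : Filter ℕ), 0 ≤ f n := Filter.Germ.coe_le.1 hx
  rw [← map_mul]
  refine Filter.Germ.coe_eq.2 ?_
  filter_upwards [h] with n hn
  exact Real.mul_self_sqrt hn


/-- The residue field `O/o` of a convex subring `O` of the
hyperreals carries a well-defined linear order, given on residues by
`π x ≤ π y ↔ (x ≤ y ∨ x - y ∈ o)`, making it a linearly ordered field with
`π` order-preserving; moreover `O/o` is real closed: nonnegative elements are
squares and odd-degree polynomials have roots. -/
theorem stmt1 (O : Subring Hyperreal)
    (hconv : ∀ x y : Hyperreal, x ∈ O → |y| ≤ |x| → y ∈ O)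
    (I : Ideal O)
    (hI : ∀ x : O, x ∈ I ↔ ((x : Hyperreal) = 0 ∨ (x : Hyperreal)⁻¹ ∉ O)) :
    ∃ le : (O ⧸ I) → (O ⧸ I) → Prop,
      -- the relation is (well-)defined on residues by the given formula
      (∀ x y : O, le (Ideal.Quotient.mk I x) (Ideal.Quotient.mk I y) ↔
        ((x : Hyperreal) ≤ (y : Hyperreal) ∨ x - y ∈ I)) ∧
      -- it is a linear order
      (∀ a, le a a) ∧
      (∀ a b c, le a b → le b c → le a c) ∧
      (∀ a b, le a b → le b a → a = b) ∧
      (∀ a b, le a b ∨ le b a) ∧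
      -- compatibility with the ring structure (ordered field)
      (∀ a b c, le a b → le (a + c) (b + c)) ∧
      (∀ a b, le 0 a → le 0 b → le 0 (a * b)) ∧
      -- O/o is a field
      (0 : O ⧸ I) ≠ 1 ∧
      (∀ u : O ⧸ I, u ≠ 0 → ∃ v : O ⧸ I, u * v = 1) ∧
      -- real closedness: nonnegative elements are squares ...
      (∀ u : O ⧸ I, le 0 u → ∃ v : O ⧸ I, v * v = u) ∧
      -- ... and every polynomial of odd degree has a root
      (∀ p : Polynomial (O ⧸ I), Odd p.natDegree → ∃ r : O ⧸ I, p.eval r = 0) := by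
  classical
  have hIconv : ∀ x y : O, x ∈ I → |(y : Hyperreal)| ≤ |(x : Hyperreal)| → y ∈ I := by
    intro x y hx hxy
    rw [hI] at hx ⊢
    by_cases hy : (y : Hyperreal) = 0
    · exact Or.inl hy
    right
    intro hyO
    have hx0 : (x : Hyperreal) ≠ 0 := by
      intro h
      rw [h, abs_zero] at hxy
      exact hy (abs_nonpos_iff.1 hxy)
    refine (hx.resolve_left hx0) (hconv _ _ hyO ?_)
    rw [abs_inv, abs_inv]
    exact inv_anti₀ (abs_pos.2 hy) hxy
  have hmk : ∀ x y : O, Ideal.Quotient.mk I x = Ideal.Quotient.mk I y ↔ x - y ∈ I :=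
    fun x y => Ideal.Quotient.eq
  have hle : ∀ x y : O, (∃ x' y' : O, Ideal.Quotient.mk I x' = Ideal.Quotient.mk I x ∧
      Ideal.Quotient.mk I y' = Ideal.Quotient.mk I y ∧ (x' : Hyperreal) ≤ y') ↔
      ((x : Hyperreal) ≤ (y : Hyperreal) ∨ x - y ∈ I) := by
    intro x y
    constructor
    · rintro ⟨x', y', hx, hy, h⟩
      rcases le_or_gt (x : Hyperreal) y with hxy | hxy
      · exact Or.inl hxy
      right
      rw [hmk] at hx hy
      refine hIconv _ _ (I.sub_mem hy hx) ?_
      push_cast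
      rw [abs_of_pos (sub_pos.2 hxy)]
      exact le_trans (by linarith) (le_abs_self _)
    · rintro (h | h)
      · exact ⟨x, y, rfl, rfl, h⟩
      · exact ⟨x, x, rfl, (hmk _ _).2 h, le_rfl⟩
  have hsurj : ∀ a : O ⧸ I, ∃ x : O, Ideal.Quotient.mk I x = a := Ideal.Quotient.mk_surjective
  have hinv : ∀ u : O ⧸ I, u ≠ 0 → ∃ v : O ⧸ I, u * v = 1 := by
    intro u hu
    obtain ⟨x, rfl⟩ := hsurj u
    rw [Ne, Ideal.Quotient.eq_zero_iff_mem, hI, not_or, not_not] at hu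
    refine ⟨Ideal.Quotient.mk I ⟨_, hu.2⟩, ?_⟩
    rw [← map_mul, ← map_one (Ideal.Quotient.mk I)]
    congr 1
    exact Subtype.ext (mul_inv_cancel₀ hu.1)
  have h01 : (0 : O ⧸ I) ≠ 1 := by
    intro h
    have h1 : (1 : O) ∈ I := by
      rw [← Ideal.Quotient.eq_zero_iff_mem, map_one]; exact h.symm
    rw [hI] at h1
    simp [O.one_mem] at h1
  have hle0 : ∀ x : O, (∃ x' y' : O, Ideal.Quotient.mk I x' = 0 ∧
      Ideal.Quotient.mk I y' = Ideal.Quotient.mk I x ∧ (x' : Hyperreal) ≤ y') →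
      ∃ z : O, Ideal.Quotient.mk I z = Ideal.Quotient.mk I x ∧ 0 ≤ (z : Hyperreal) := by
    intro x h
    have h' := (hle 0 x).1 (by simpa using h)
    rcases h' with h' | h'
    · exact ⟨x, rfl, by simpa using h'⟩
    · exact ⟨0, (hmk _ _).2 h', by simp⟩
  refine ⟨fun a b => ∃ x' y' : O, Ideal.Quotient.mk I x' = a ∧ Ideal.Quotient.mk I y' = b ∧
    (x' : Hyperreal) ≤ y', hle, ?_, ?_, ?_, ?_, ?_, ?_, h01, hinv, ?_, ?_⟩
  · intro a
    obtain ⟨x, rfl⟩ := hsurj a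
    exact ⟨x, x, rfl, rfl, le_rfl⟩
  · rintro a b c ⟨x, y, rfl, rfl, h⟩ ⟨y', z, hy, rfl, h'⟩
    refine ⟨x, z + (y - y'), rfl, ?_, ?_⟩
    · rw [map_add, map_sub, hy, sub_self, add_zero]
    · push_cast
      linarith
  · intro a b h h'
    obtain ⟨x, rfl⟩ := hsurj a
    obtain ⟨y, rfl⟩ := hsurj b
    rcases (hle _ _).1 h with h | h
    · rcases (hle _ _).1 h' with h' | h'
      · rw [Subtype.ext (le_antisymm h h')]
      · exact ((hmk _ _).2 h').symm
    · exact (hmk _ _).2 h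
  · intro a b
    obtain ⟨x, rfl⟩ := hsurj a
    obtain ⟨y, rfl⟩ := hsurj b
    rcases le_total (x : Hyperreal) y with h | h
    · exact Or.inl ⟨x, y, rfl, rfl, h⟩
    · exact Or.inr ⟨y, x, rfl, rfl, h⟩
  · rintro a b c ⟨x, y, rfl, rfl, h⟩
    obtain ⟨z, rfl⟩ := hsurj c
    refine ⟨x + z, y + z, map_add _ _ _, map_add _ _ _, ?_⟩
    push_cast
    linarith
  · intro a b ha hb
    obtain ⟨x, rfl⟩ := hsurj a
    obtain ⟨y, rfl⟩ := hsurj b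
    obtain ⟨z, hz, hz0⟩ := hle0 x ha
    obtain ⟨w, hw, hw0⟩ := hle0 y hb
    refine ⟨0, z * w, map_zero _, by rw [map_mul, hz, hw], ?_⟩
    push_cast
    exact mul_nonneg hz0 hw0
  · intro u hu
    obtain ⟨x, rfl⟩ := hsurj u
    obtain ⟨z, hz, hz0⟩ := hle0 x hu
    obtain ⟨s, hs⟩ := hyper_sqrt z hz0
    have hsO : s ∈ O := by
      rcases le_total |s| 1 with h | h
      · exact hconv 1 s O.one_mem (by simpa using h)
      · refine hconv z s z.2 ?_
        rw [← hs, abs_mul]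
        nlinarith
    refine ⟨Ideal.Quotient.mk I ⟨s, hsO⟩, ?_⟩
    rw [← hz, ← map_mul]
    congr 1
    exact Subtype.ext hs
  · intro p hp
    have : Nontrivial (O ⧸ I) := ⟨0, 1, h01⟩
    have hp0 : p ≠ 0 := by
      rintro rfl
      simp at hp
    obtain ⟨v, hv⟩ := hinv _ (Polynomial.leadingCoeff_ne_zero.2 hp0)
    have hqm := Polynomial.monic_mul_C_of_leadingCoeff_mul_eq_one hv
    have hqd : (p * Polynomial.C v).natDegree = p.natDegree :=
      Polynomial.natDegree_mul_C_eq_of_mul_ne_zero (by rw [hv]; exact h01.symm)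
    obtain ⟨Q, hQ, hd, hQm⟩ := Polynomial.lifts_and_natDegree_eq_and_monic
      (f := Ideal.Quotient.mk I) ((Polynomial.lifts_iff_coeff_lifts _).2 fun n => hsurj _) hqm
    obtain ⟨r, hr⟩ := hyper_odd_root (Q.map O.subtype) (hQm.map _)
      (by rw [hQm.natDegree_map, hd, hqd]; exact hp)
    let A : ValuationSubring Hyperreal :=
      { O with
        mem_or_inv_mem' := fun x => by
          rcases le_total |x| 1 with h | h
          · exact Or.inl (hconv 1 x O.one_mem (by simpa using h))
          · refine Or.inr (hconv 1 _ O.one_mem ?_)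
            rw [abs_inv, abs_one]
            exact inv_le_one_of_one_le₀ h }
    have hrO : r ∈ O := by
      have hrint : IsIntegral A r := ⟨Q, hQm, by rw [Polynomial.eval_map] at hr; exact hr⟩
      obtain ⟨y, hy⟩ := IsIntegrallyClosed.isIntegral_iff.1 hrint
      rw [← hy]
      exact y.2
    have hQr : Q.eval ⟨r, hrO⟩ = 0 := by
      apply Subtype.ext
      rw [Polynomial.eval_map] at hr
      exact (Polynomial.eval₂_at_apply (p := Q) O.subtype ⟨r, hrO⟩).symm.trans hr
    refine ⟨Ideal.Quotient.mk I ⟨r, hrO⟩, ?_⟩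
    have h1 : (p * Polynomial.C v).eval (Ideal.Quotient.mk I ⟨r, hrO⟩) = 0 := by
      rw [← hQ, Polynomial.eval_map, Polynomial.eval₂_at_apply, hQr, map_zero]
    rw [Polynomial.eval_mul, Polynomial.eval_C] at h1
    linear_combination p.leadingCoeff * h1 - (p.eval (Ideal.Quotient.mk I ⟨r, hrO⟩)) * hv
end

section
/- Any two convex subrings of the hyperreal field ℝ* are comparable under inclusion: if O₁ and O₂ are convex subrings of ℝ*, then O₁ ⊆ O₂ or O₂ ⊆ O₁. Moreover the set ℝ*_fin := {x ∈ ℝ* : ∃ n : ℕ, |x| ≤ n} of finite hyperreals is itself a convex subring of ℝ*, and every convex subring O of ℝ* contains ℝ*_fin (so ℝ*_fin is the smallest convex subring of ℝ*). -/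
/-- Convex subrings of the hyperreals are linearly ordered by
inclusion, the finite hyperreals form a convex subring, and every convex
subring contains the finite hyperreals. -/
theorem stmt2 :
    (∀ O₁ O₂ : Subring Hyperreal,
      (∀ x y : Hyperreal, x ∈ O₁ → |y| ≤ |x| → y ∈ O₁) →
      (∀ x y : Hyperreal, x ∈ O₂ → |y| ≤ |x| → y ∈ O₂) →
      (O₁ : Set Hyperreal) ⊆ O₂ ∨ (O₂ : Set Hyperreal) ⊆ O₁) ∧
    (∃ F : Subring Hyperreal,
      (∀ x : Hyperreal, x ∈ F ↔ ∃ n : ℕ, |x| ≤ (n : Hyperreal)) ∧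
      (∀ x y : Hyperreal, x ∈ F → |y| ≤ |x| → y ∈ F) ∧
      (∀ O : Subring Hyperreal,
        (∀ x y : Hyperreal, x ∈ O → |y| ≤ |x| → y ∈ O) →
        (F : Set Hyperreal) ⊆ O)) := by
  refine ⟨?_, ?_⟩
  · intro O₁ O₂ h₁ h₂
    by_contra hcon
    rw [not_or, Set.not_subset, Set.not_subset] at hcon
    obtain ⟨⟨a, ha1, ha2⟩, ⟨b, hb2, hb1⟩⟩ := hcon
    rcases le_total |a| |b| with h | h
    · exact ha2 (h₂ b a hb2 h)
    · exact hb1 (h₁ a b ha1 h)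
  · let F : Subring Hyperreal :=
      { carrier := {x | ∃ n : ℕ, |x| ≤ (n : Hyperreal)}
        mul_mem' := by
          rintro a b ⟨m, hm⟩ ⟨n, hn⟩
          refine ⟨m * n, ?_⟩
          rw [abs_mul, Nat.cast_mul]
          exact mul_le_mul hm hn (abs_nonneg _) (Nat.cast_nonneg _)
        one_mem' := ⟨1, by simp⟩
        add_mem' := by
          rintro a b ⟨m, hm⟩ ⟨n, hn⟩
          refine ⟨m + n, ?_⟩
          rw [Nat.cast_add]
          exact (abs_add_le a b).trans (add_le_add hm hn)
        zero_mem' := ⟨0, by simp⟩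
        neg_mem' := by
          rintro a ⟨m, hm⟩
          exact ⟨m, by rwa [abs_neg]⟩ }
    refine ⟨F, fun x => Iff.rfl, ?_, ?_⟩
    · rintro x y ⟨n, hn⟩ hxy
      exact ⟨n, hxy.trans hn⟩
    · rintro O hO x ⟨n, hn⟩
      exact hO (n : Hyperreal) x (natCast_mem O n) (hn.trans (le_abs_self _))
end

section
/- Let ξ ∈ ℝ* satisfy ξ > r for every real number r, and define iterated exponentials by exp₀(ξ) := ξ and expₙ₊₁(ξ) := *exp(expₙ(ξ)), where *exp is the nonstandard extension of the real exponential function. Then the set E := {x ∈ ℝ* : ∃ n, |x| ≤ expₙ(ξ)} is a convex subring of ℝ* containing ξ and closed under *exp (i.e., x ∈ E implies *exp(x) ∈ E); and E is the smallest such: for every convex subring O of ℝ* with ξ ∈ O that is closed under *exp, one has E ⊆ O. -/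
/-- The nonstandard extension of the real exponential function. -/
noncomputable def starExp : Hyperreal → Hyperreal :=
  Filter.Germ.map Real.exp

theorem starExp_mono {x y : Hyperreal} (h : x ≤ y) : starExp x ≤ starExp y := by
  obtain ⟨f, rfl⟩ := Hyperreal.ofSeq_surjective x
  obtain ⟨g, rfl⟩ := Hyperreal.ofSeq_surjective y
  rw [Hyperreal.ofSeq_le_ofSeq] at h
  change Hyperreal.ofSeq (fun n => Real.exp (f n)) ≤ Hyperreal.ofSeq (fun n => Real.exp (g n))
  rw [Hyperreal.ofSeq_le_ofSeq]
  filter_upwards [h] with n hn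
  exact Real.exp_le_exp.2 hn

theorem add_one_le_starExp (x : Hyperreal) : x + 1 ≤ starExp x := by
  obtain ⟨f, rfl⟩ := Hyperreal.ofSeq_surjective x
  change Hyperreal.ofSeq (fun n => f n + 1) ≤ Hyperreal.ofSeq (fun n => Real.exp (f n))
  rw [Hyperreal.ofSeq_le_ofSeq]
  exact Filter.Eventually.of_forall fun n => Real.add_one_le_exp (f n)

theorem starExp_nonneg (x : Hyperreal) : 0 ≤ starExp x := by
  obtain ⟨f, rfl⟩ := Hyperreal.ofSeq_surjective x
  change Hyperreal.ofSeq (fun _ => 0) ≤ Hyperreal.ofSeq (fun n => Real.exp (f n))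
  rw [Hyperreal.ofSeq_le_ofSeq]
  exact Filter.Eventually.of_forall fun n => (Real.exp_pos (f n)).le

theorem real_sq_le_exp {x : ℝ} (hx : 0 ≤ x) : x * x ≤ Real.exp x := by
  have h1 : x ≤ Real.exp (x / 2) := by
    have e : Real.exp (x / 2) = Real.exp 1 * Real.exp (x / 2 - 1) := by
      rw [← Real.exp_add]; ring_nf
    have h2 := Real.add_one_le_exp (x / 2 - 1)
    have h3 := Real.add_one_le_exp (1 : ℝ)
    rw [e]
    nlinarith
  have e : Real.exp x = Real.exp (x / 2) * Real.exp (x / 2) := by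
    rw [← Real.exp_add]; ring_nf
  rw [e]
  exact mul_self_le_mul_self hx h1

theorem sq_le_starExp {x : Hyperreal} (hx : 0 ≤ x) : x * x ≤ starExp x := by
  obtain ⟨f, rfl⟩ := Hyperreal.ofSeq_surjective x
  change Hyperreal.ofSeq (fun _ => 0) ≤ Hyperreal.ofSeq f at hx
  change Hyperreal.ofSeq (fun n => f n * f n) ≤ Hyperreal.ofSeq (fun n => Real.exp (f n))
  rw [Hyperreal.ofSeq_le_ofSeq] at hx ⊢
  filter_upwards [hx] with n hn
  exact real_sq_le_exp hn

/-- For `ξ > ℝ` in the hyperreals, the set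
`E = {x : ∃ n, |x| ≤ expₙ(ξ)}` is a convex subring of `ℝ*` containing `ξ`,
closed under `*exp`, and is the smallest such convex subring. -/
theorem stmt4 (ξ : Hyperreal) (hξ : ∀ r : ℝ, (r : Hyperreal) < ξ)
    (iterexp : ℕ → Hyperreal) (h0 : iterexp 0 = ξ)
    (hs : ∀ n : ℕ, iterexp (n + 1) = starExp (iterexp n)) :
    ∃ E : Subring Hyperreal,
      (∀ x : Hyperreal, x ∈ E ↔ ∃ n : ℕ, |x| ≤ iterexp n) ∧
      (∀ x y : Hyperreal, x ∈ E → |y| ≤ |x| → y ∈ E) ∧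
      ξ ∈ E ∧
      (∀ x ∈ E, starExp x ∈ E) ∧
      (∀ O : Subring Hyperreal,
        (∀ x y : Hyperreal, x ∈ O → |y| ≤ |x| → y ∈ O) →
        ξ ∈ O → (∀ x ∈ O, starExp x ∈ O) →
        (E : Set Hyperreal) ⊆ O) := by
  have h2ξ : (2 : Hyperreal) ≤ ξ := by
    have := (hξ 2).le
    rwa [Hyperreal.coe_ofNat] at this
  have hstep : ∀ n, iterexp n ≤ iterexp (n + 1) := fun n => by
    rw [hs]
    have := add_one_le_starExp (iterexp n)
    linarith
  have hmono : Monotone iterexp := monotone_nat_of_le_succ hstep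
  have h2 : ∀ n, 2 ≤ iterexp n := fun n =>
    h2ξ.trans (h0 ▸ hmono (Nat.zero_le n))
  have hsq : ∀ n, iterexp n * iterexp n ≤ iterexp (n + 1) := fun n => by
    rw [hs]
    exact sq_le_starExp (by linarith [h2 n])
  have hcommon : ∀ {x y : Hyperreal}, (∃ n, |x| ≤ iterexp n) → (∃ n, |y| ≤ iterexp n) →
      ∃ n, |x| ≤ iterexp n ∧ |y| ≤ iterexp n := by
    rintro x y ⟨n, hn⟩ ⟨m, hm⟩
    exact ⟨max n m, hn.trans (hmono (le_max_left _ _)), hm.trans (hmono (le_max_right _ _))⟩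
  let E : Subring Hyperreal :=
    { carrier := {x | ∃ n : ℕ, |x| ≤ iterexp n}
      zero_mem' := ⟨0, by rw [abs_zero]; linarith [h2 0]⟩
      one_mem' := ⟨0, by rw [abs_one]; linarith [h2 0]⟩
      neg_mem' := by
        rintro x ⟨n, hn⟩
        exact ⟨n, by rwa [abs_neg]⟩
      add_mem' := by
        intro x y hx hy
        obtain ⟨n, h, h'⟩ := hcommon hx hy
        refine ⟨n + 1, ?_⟩
        have := abs_add_le x y
        nlinarith [h2 n, hsq n]
      mul_mem' := by
        intro x y hx hy
        obtain ⟨n, h, h'⟩ := hcommon hx hy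
        refine ⟨n + 1, ?_⟩
        rw [abs_mul]
        exact (mul_le_mul h h' (abs_nonneg _) (by linarith [h2 n])).trans (hsq n) }
  refine ⟨E, fun x => Iff.rfl, ?_, ?_, ?_, ?_⟩
  · rintro x y ⟨n, hn⟩ hxy
    exact ⟨n, hxy.trans hn⟩
  · exact ⟨0, by rw [h0, abs_of_nonneg (by linarith)]⟩
  · rintro x ⟨n, hn⟩
    refine ⟨n + 1, ?_⟩
    rw [abs_of_nonneg (starExp_nonneg x), hs]
    exact starExp_mono ((le_abs_self x).trans hn)
  · rintro O hO hξO hexp x ⟨n, hn⟩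
    have hmem : ∀ n, iterexp n ∈ O := by
      intro n
      induction n with
      | zero => rw [h0]; exact hξO
      | succ k ih => rw [hs]; exact hexp _ ih
    exact hO _ _ (hmem n) (hn.trans (le_abs_self _))
end

section
/- Let ξ ∈ ℝ* satisfy ξ > r for every real number r, define exp₀(ξ) := ξ and expₙ₊₁(ξ) := *exp(expₙ(ξ)), and let E := {x ∈ ℝ* : ∃ n, |x| ≤ expₙ(ξ)}. Then the maximal ideal of the convex subring E admits the description: for every x ∈ ℝ*, one has (x = 0 ∨ x⁻¹ ∉ E) together with x ∈ E if and only if |x| ≤ (expₙ(ξ))⁻¹ for all n. In other words, the set e := {x ∈ ℝ* : ∀ n, |x| ≤ 1/expₙ(ξ)} equals the set of non-units of E. -/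
/-- The maximal ideal of `E` is
`e = {x : ∀ n, |x| ≤ 1/expₙ(ξ)}`: an element `x` satisfies
`(x = 0 ∨ x⁻¹ ∉ E) ∧ x ∈ E` iff `|x| ≤ (expₙ(ξ))⁻¹` for all `n`, and `e`
equals the set of non-units of `E`. -/
theorem stmt5 (ξ : Hyperreal) (hξ : ∀ r : ℝ, (r : Hyperreal) < ξ)
    (iterexp : ℕ → Hyperreal) (h0 : iterexp 0 = ξ)
    (hs : ∀ n : ℕ, iterexp (n + 1) = starExp (iterexp n))
    (E : Subring Hyperreal)
    (hE : ∀ x : Hyperreal, x ∈ E ↔ ∃ n : ℕ, |x| ≤ iterexp n) :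
    (∀ x : Hyperreal,
      ((x = 0 ∨ x⁻¹ ∉ E) ∧ x ∈ E) ↔ ∀ n : ℕ, |x| ≤ (iterexp n)⁻¹) ∧
    (∀ x : Hyperreal,
      (∀ n : ℕ, |x| ≤ 1 / iterexp n) ↔ (x ∈ E ∧ ¬∃ y ∈ E, x * y = 1)) := by
  have key : ∀ x : Hyperreal, x < starExp x := by
    intro x
    induction x using Filter.Germ.inductionOn with
    | _ f =>
      refine Filter.Germ.coe_lt.2 (Filter.Eventually.of_forall fun n => ?_)
      have := Real.add_one_le_exp (f n)
      simp only [Function.comp]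
      linarith
  have hξ1 : (1 : Hyperreal) < ξ := by simpa using hξ 1
  have hlt : ∀ n, iterexp n < iterexp (n + 1) := fun n => by
    rw [hs]; exact key _
  have hone : ∀ n, 1 < iterexp n := by
    intro n
    induction n with
    | zero => rw [h0]; exact hξ1
    | succ k ih => exact ih.trans (hlt k)
  have hpos : ∀ n, 0 < iterexp n := fun n => zero_lt_one.trans (hone n)
  have main : ∀ x : Hyperreal,
      ((x = 0 ∨ x⁻¹ ∉ E) ∧ x ∈ E) ↔ ∀ n : ℕ, |x| ≤ (iterexp n)⁻¹ := by
    intro x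
    constructor
    · rintro ⟨h | h, -⟩ n
      · rw [h, abs_zero]; exact (inv_pos.2 (hpos n)).le
      · rw [hE] at h
        push Not at h
        have h1 := h n
        rw [abs_inv] at h1
        have hx : 0 < |x| := inv_pos.1 ((hpos n).trans h1)
        exact ((lt_inv_comm₀ (hpos n) hx).1 h1).le
    · intro h
      refine ⟨?_, (hE x).2 ⟨0, ?_⟩⟩
      · by_cases hx : x = 0
        · exact Or.inl hx
        · right
          rw [hE]
          rintro ⟨m, hm⟩
          have hx' : 0 < |x| := abs_pos.2 hx
          rw [abs_inv] at hm
          have h2 := (le_inv_comm₀ hx' (hpos (m + 1))).1 (h (m + 1))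
          exact absurd (h2.trans hm) (not_le.2 (hlt m))
      · exact (h 0).trans ((inv_le_one_of_one_le₀ (hone 0).le).trans (hone 0).le)
  refine ⟨main, fun x => ?_⟩
  simp only [one_div]
  rw [← main x]
  constructor
  · rintro ⟨h, hx⟩
    refine ⟨hx, ?_⟩
    rintro ⟨y, hy, hxy⟩
    rcases h with h | h
    · rw [h, zero_mul] at hxy
      exact zero_ne_one hxy
    · exact h (by rwa [inv_eq_of_mul_eq_one_right hxy])
  · rintro ⟨hx, h⟩
    refine ⟨?_, hx⟩
    by_cases h0 : x = 0
    · exact Or.inl h0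
    · exact Or.inr fun hi => h ⟨x⁻¹, hi, mul_inv_cancel₀ h0⟩
end

section
/- Let O be a convex subring of ℝ* that is closed under *exp (i.e., x ∈ O implies *exp(x) ∈ O), and let o := {x ∈ ℝ* : x = 0 ∨ x⁻¹ ∉ O}. Then for all f, g ∈ O with f − g ∈ o, one has *exp(f) ∈ O, *exp(g) ∈ O, and *exp(f) − *exp(g) ∈ o. Consequently the nonstandard exponential induces a well-defined function on the residue field O/o. -/
theorem starExp_pos (f : Hyperreal) : 0 < starExp f := by
  induction f using Filter.Germ.inductionOn with | _ f => ?_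
  exact Filter.Germ.coe_lt.2 (Filter.Eventually.of_forall fun n => Real.exp_pos (f n))

theorem starExp_sub_le_aux (f g : Hyperreal) :
    starExp f - starExp g ≤ (f - g) * starExp f := by
  induction f using Filter.Germ.inductionOn with | _ f => ?_
  induction g using Filter.Germ.inductionOn with | _ g => ?_
  have key : ∀ x y : ℝ, Real.exp x - Real.exp y ≤ (x - y) * Real.exp x := by
    intro x y
    have h := Real.add_one_le_exp (y - x)
    have e : Real.exp y = Real.exp x * Real.exp (y - x) := by
      rw [← Real.exp_add]; congr 1; ring
    have hx := Real.exp_pos x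
    rw [e]; nlinarith
  exact Filter.Germ.coe_le.2 (Filter.Eventually.of_forall fun n => key (f n) (g n))

theorem starExp_sub_le (f g : Hyperreal) :
    |starExp f - starExp g| ≤ |f - g| * (starExp f + starExp g) := by
  have h1 : ∀ x y : Hyperreal,
      starExp x - starExp y ≤ |x - y| * (starExp x + starExp y) := by
    intro x y
    have h2 := starExp_sub_le_aux x y
    have h3 : (x - y) * starExp x ≤ |x - y| * starExp x :=
      mul_le_mul_of_nonneg_right (le_abs_self _) (starExp_pos x).le
    have h4 : 0 ≤ |x - y| * starExp y := mul_nonneg (abs_nonneg _) (starExp_pos y).le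
    rw [mul_add]
    linarith
  rw [abs_le]
  refine ⟨?_, h1 f g⟩
  have h := h1 g f
  rw [abs_sub_comm, add_comm] at h
  linarith

/-- If the convex subring `O` of `ℝ*` is closed under `*exp`,
then for `f, g ∈ O` with `f - g ∈ o` one has `*exp f, *exp g ∈ O` and
`*exp f - *exp g ∈ o`; so `*exp` induces a function on the residue field. -/
theorem stmt6 (O : Subring Hyperreal)
    (hconv : ∀ x y : Hyperreal, x ∈ O → |y| ≤ |x| → y ∈ O)
    (hexp : ∀ x ∈ O, starExp x ∈ O)
    (o : Set Hyperreal) (ho : o = {x : Hyperreal | x = 0 ∨ x⁻¹ ∉ O}) :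
    ∀ f g : Hyperreal, f ∈ O → g ∈ O → f - g ∈ o →
      starExp f ∈ O ∧ starExp g ∈ O ∧ starExp f - starExp g ∈ o := by
  intro f g hf hg hfg
  have hF := hexp f hf
  have hG := hexp g hg
  refine ⟨hF, hG, ?_⟩
  subst ho
  rw [Set.mem_ofPred_eq] at hfg ⊢
  by_cases hfg0 : f - g = 0
  · left
    rw [sub_eq_zero.1 hfg0, sub_self]
  have hn := hfg.resolve_left hfg0
  by_cases hE : starExp f - starExp g = 0
  · exact Or.inl hE
  right
  intro hinv
  apply hn
  refine hconv _ _ (O.mul_mem hinv (O.add_mem hF hG)) ?_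
  have h := starExp_sub_le f g
  have ha : 0 < |f - g| := abs_pos.2 hfg0
  have hb : 0 < |starExp f - starExp g| := abs_pos.2 hE
  have hc : |f - g| * (starExp f + starExp g) ≤ |f - g| * |starExp f + starExp g| :=
    mul_le_mul_of_nonneg_left (le_abs_self _) ha.le
  rw [abs_mul, abs_inv, abs_inv, inv_mul_eq_div, inv_eq_one_div, div_le_div_iff₀ ha hb]
  linarith
end

section
/- Let O be a convex subring of ℝ*. If g ∈ O satisfies g > 0 and g⁻¹ ∈ O (equivalently, g is a positive unit of O, i.e., g does not lie in the maximal ideal o := {x : x = 0 ∨ x⁻¹ ∉ O}), then *log(g) ∈ O, where *log := Filter.Germ.map Real.log, and moreover *exp(*log(g)) = g. -/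
/-- The nonstandard extension of the real logarithm function. -/
noncomputable def starLog : Hyperreal → Hyperreal :=
  Filter.Germ.map Real.log

/-- If `g` is a positive unit of the convex subring `O` of `ℝ*`
(i.e. `g > 0`, `g ∈ O`, `g⁻¹ ∈ O`), then `*log g ∈ O` and
`*exp (*log g) = g`. -/
theorem stmt7 (O : Subring Hyperreal)
    (hconv : ∀ x y : Hyperreal, x ∈ O → |y| ≤ |x| → y ∈ O)
    (g : Hyperreal) (hg : g ∈ O) (hgpos : 0 < g) (hginv : g⁻¹ ∈ O) :
    starLog g ∈ O ∧ starExp (starLog g) = g := by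
  obtain ⟨f, rfl⟩ := Hyperreal.ofSeq_surjective g
  have hpos : ∀ᶠ n in (Filter.hyperfilter ℕ : Filter ℕ), 0 < f n :=
    (Hyperreal.ofSeq_lt_ofSeq (f := fun _ => 0)).1 hgpos
  constructor
  · refine hconv (Hyperreal.ofSeq f + (Hyperreal.ofSeq f)⁻¹) _ (O.add_mem hg hginv) ?_
    refine le_trans ?_ (le_abs_self _)
    rw [abs_le']
    have hkey : ∀ x : ℝ, 0 < x → Real.log x ≤ x + x⁻¹ ∧ -Real.log x ≤ x + x⁻¹ := by
      intro x hx
      have hi : 0 < x⁻¹ := inv_pos.2 hx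
      have h1 := Real.log_le_sub_one_of_pos hx
      have h2 := Real.log_le_sub_one_of_pos hi
      rw [Real.log_inv] at h2
      constructor <;> linarith
    constructor
    · exact Hyperreal.ofSeq_le_ofSeq (f := fun n => Real.log (f n))
        (g := fun n => f n + (f n)⁻¹) |>.2 (hpos.mono fun n hn => (hkey _ hn).1)
    · exact Hyperreal.ofSeq_le_ofSeq (f := fun n => -Real.log (f n))
        (g := fun n => f n + (f n)⁻¹) |>.2 (hpos.mono fun n hn => (hkey _ hn).2)
  · exact Filter.Germ.coe_eq.2 (hpos.mono fun n hn => Real.exp_log hn)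
end

section
/- Let n ≥ 1, let B = ∏ᵢ (aᵢ, bᵢ) ⊆ ℝⁿ be an open box (aᵢ < bᵢ real numbers), and let f : (Fin n → ℝ) → ℝ be continuously differentiable on B (ContDiffOn ℝ 1 f B). Let x be a point of the monad of B, i.e., x is a germ over the hyperfilter on ℕ of maps Fin n → ℝ such that for every i, the hyperreal coordinate xᵢ := x.map (fun v => v i) is finite and its standard part lies in (aᵢ, bᵢ). Then: (a) the hyperreal *f(x) := x.map f is finite; and (b) for every convex subring O of ℝ* with o := {z ∈ ℝ* : z = 0 ∨ z⁻¹ ∉ O}, if y is also in the monad of B and xᵢ − yᵢ ∈ o for all i, then *f(x) − *f(y) ∈ o. -/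
/-- Points of `*ℝⁿ`: germs over the hyperfilter on `ℕ` of maps `Fin n → ℝ`. -/
abbrev HyperPoint (n : ℕ) : Type :=
  Filter.Germ (Filter.hyperfilter ℕ : Filter ℕ) (Fin n → ℝ)

/-- The `i`-th hyperreal coordinate of a point of `*ℝⁿ`. -/
noncomputable def coord {n : ℕ} (x : HyperPoint n) (i : Fin n) : Hyperreal :=
  x.map (fun v => v i)

/-- Value at `x ∈ *ℝⁿ` of the nonstandard extension of `f : ℝⁿ → ℝ`. -/
noncomputable def starFun {n : ℕ} (f : (Fin n → ℝ) → ℝ) (x : HyperPoint n) :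
    Hyperreal :=
  x.map f

/-- A hyperreal is finite if its absolute value is at most some natural number. -/
def IsFiniteHyper (x : Hyperreal) : Prop :=
  ∃ m : ℕ, |x| ≤ (m : Hyperreal)

/-- Membership in the monad of the open box `∏ i, (a i, b i)`. -/
noncomputable def InMonad {n : ℕ} (a b : Fin n → ℝ) (x : HyperPoint n) : Prop :=
  ∀ i : Fin n, IsFiniteHyper (coord x i) ∧
    Hyperreal.st (coord x i) ∈ Set.Ioo (a i) (b i)

theorem aux_tendsto (x : Hyperreal) (hx : IsFiniteHyper x) (X : ℕ → ℝ)
    (hX : x = Hyperreal.ofSeq X) :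
    Filter.Tendsto X (Filter.hyperfilter ℕ : Filter ℕ) (nhds (Hyperreal.st x)) := by
  obtain ⟨m, hm⟩ := hx
  have h : ¬ Hyperreal.Infinite x := by
    rw [Hyperreal.not_infinite_iff_exist_lt_gt]
    refine ⟨-(m + 1 : ℝ), (m + 1 : ℝ), ?_, ?_⟩
    · have := (abs_le.1 hm).1
      have e : ((-(m + 1 : ℝ) : ℝ) : Hyperreal) = -((m : Hyperreal) + 1) := rfl
      rw [e]; linarith
    · have := (abs_le.1 hm).2
      have e : (((m + 1 : ℝ) : ℝ) : Hyperreal) = ((m : Hyperreal) + 1) := rfl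
      rw [e]; linarith
  have h2 := Hyperreal.isSt_st' h
  rw [hX] at h2 ⊢
  exact Hyperreal.isSt_ofSeq_iff_tendsto.1 h2

theorem aux_small (O : Subring Hyperreal)
    (hO : ∀ z w : Hyperreal, z ∈ O → |w| ≤ |z| → w ∈ O)
    (d e : Hyperreal) (m : ℕ) (hd : d = 0 ∨ d⁻¹ ∉ O) (h : |e| ≤ m * |d|) :
    e = 0 ∨ e⁻¹ ∉ O := by
  by_cases he : e = 0
  · exact Or.inl he
  right
  intro hi
  have hepos : 0 < |e| := abs_pos.2 he
  have hdne : d ≠ 0 := by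
    rintro rfl
    simp at h
    exact he h
  have hdpos : 0 < |d| := abs_pos.2 hdne
  refine (hd.resolve_left hdne) (hO (m * e⁻¹) _ (O.mul_mem (natCast_mem O m) hi) ?_)
  rw [abs_mul, abs_inv, abs_inv, Nat.abs_cast, ← div_eq_mul_inv, le_div_iff₀ hepos,
    inv_mul_le_iff₀ hdpos]
  linarith

/-- If `f` is `C¹` on the open box `B` and `x` lies in the monad
of `B`, then (a) `*f(x)` is finite, and (b) for every convex subring `O` of
`ℝ*` with maximal ideal `o`, if `y` is in the monad of `B` and `xᵢ - yᵢ ∈ o`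
for all `i`, then `*f(x) - *f(y) ∈ o`. -/
theorem stmt12 (n : ℕ) (hn : 1 ≤ n) (a b : Fin n → ℝ) (hab : ∀ i, a i < b i)
    (f : (Fin n → ℝ) → ℝ)
    (hf : ContDiffOn ℝ 1 f {v : Fin n → ℝ | ∀ i, v i ∈ Set.Ioo (a i) (b i)})
    (x : HyperPoint n) (hx : InMonad a b x) :
    IsFiniteHyper (starFun f x) ∧
    ∀ O : Subring Hyperreal,
      (∀ z w : Hyperreal, z ∈ O → |w| ≤ |z| → w ∈ O) →
      ∀ o : Set Hyperreal, o = {z : Hyperreal | z = 0 ∨ z⁻¹ ∉ O} →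
      ∀ y : HyperPoint n, InMonad a b y →
        (∀ i : Fin n, coord x i - coord y i ∈ o) →
        starFun f x - starFun f y ∈ o := by
  obtain ⟨X, rfl⟩ : ∃ X : ℕ → (Fin n → ℝ), x = (X : HyperPoint n) := by
    obtain ⟨X, h⟩ := Quot.exists_rep x
    exact ⟨X, h.symm⟩
  set p : Fin n → ℝ := fun i => Hyperreal.st (coord (X : HyperPoint n) i) with hp
  have hXt : Filter.Tendsto X (Filter.hyperfilter ℕ : Filter ℕ) (nhds p) :=
    tendsto_pi_nhds.2 fun i => aux_tendsto _ (hx i).1 (fun k => X k i) rfl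
  have hopen : IsOpen {v : Fin n → ℝ | ∀ i, v i ∈ Set.Ioo (a i) (b i)} := by
    have : {v : Fin n → ℝ | ∀ i, v i ∈ Set.Ioo (a i) (b i)} =
        Set.univ.pi fun i => Set.Ioo (a i) (b i) := by ext; simp
    rw [this]
    exact isOpen_set_pi Set.finite_univ fun i _ => isOpen_Ioo
  have hpB : p ∈ {v : Fin n → ℝ | ∀ i, v i ∈ Set.Ioo (a i) (b i)} := fun i => (hx i).2
  have hfp : ContDiffAt ℝ 1 f p := hf.contDiffAt (hopen.mem_nhds hpB)
  constructor
  · obtain ⟨m, hm⟩ := exists_nat_gt |f p|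
    refine ⟨m, ?_⟩
    have h1 : Filter.Tendsto (fun k => |f (X k)|) (Filter.hyperfilter ℕ : Filter ℕ)
        (nhds |f p|) := (hfp.continuousAt.tendsto.comp hXt).abs
    have h2 := h1.eventually (gt_mem_nhds hm)
    have : Hyperreal.ofSeq (fun k => |f (X k)|) ≤ Hyperreal.ofSeq (fun _ => (m : ℝ)) :=
      Hyperreal.ofSeq_le_ofSeq.2 (h2.mono fun k hk => hk.le)
    have e : |starFun f (X : HyperPoint n)| = Hyperreal.ofSeq (fun k => |f (X k)|) :=
      (Filter.Germ.abs_def _)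
    rw [e]
    exact this
  · rintro O hO o rfl y hy hxy
    obtain ⟨Y, rfl⟩ : ∃ Y : ℕ → (Fin n → ℝ), y = (Y : HyperPoint n) := by
      obtain ⟨Y, h⟩ := Quot.exists_rep y
      exact ⟨Y, h.symm⟩
    have eabs : ∀ i, |coord (X : HyperPoint n) i - coord (Y : HyperPoint n) i| =
        Hyperreal.ofSeq (fun k => |X k i - Y k i|) := fun i => Filter.Germ.abs_def _
    have hst : ∀ i, Hyperreal.st (coord (Y : HyperPoint n) i) = p i := by
      intro i
      have tx := aux_tendsto _ (hx i).1 (fun k => X k i) rfl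
      have ty := aux_tendsto _ (hy i).1 (fun k => Y k i) rfl
      have td := (tx.sub ty).abs
      by_contra hne
      have hpos : 0 < |p i - Hyperreal.st (coord (Y : HyperPoint n) i)| :=
        abs_pos.2 (sub_ne_zero.2 (Ne.symm hne))
      obtain ⟨m, hm⟩ := exists_nat_gt (|p i - Hyperreal.st (coord (Y : HyperPoint n) i)|⁻¹)
      have hm0 : (0 : ℝ) < m := lt_trans (inv_pos.2 hpos) hm
      have hm' : (m : ℝ)⁻¹ < |p i - Hyperreal.st (coord (Y : HyperPoint n) i)| :=
        inv_lt_of_inv_lt₀ hpos hm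
      have h2 := td.eventually (lt_mem_nhds hm')
      have h3 : Hyperreal.ofSeq (fun _ => (1 : ℝ)) ≤
          Hyperreal.ofSeq (fun k => (m : ℝ) * |X k i - Y k i|) := by
        refine Hyperreal.ofSeq_le_ofSeq.2 (h2.mono fun k hk => ?_)
        rw [inv_lt_iff_one_lt_mul₀ hm0] at hk
        linarith
      have h4 : |(1 : Hyperreal)| ≤
          m * |coord (X : HyperPoint n) i - coord (Y : HyperPoint n) i| := by
        rw [eabs, abs_one]; exact h3
      rcases aux_small O hO _ _ m (hxy i) h4 with h | h
      · exact one_ne_zero h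
      · rw [inv_one] at h
        exact h O.one_mem
    have hYt : Filter.Tendsto Y (Filter.hyperfilter ℕ : Filter ℕ) (nhds p) :=
      tendsto_pi_nhds.2 fun i => by
        have := aux_tendsto _ (hy i).1 (fun k => Y k i) rfl
        rwa [hst i] at this
    obtain ⟨K, t, ht, hK⟩ := hfp.exists_lipschitzOnWith
    obtain ⟨m, hm⟩ := exists_nat_ge (K : ℝ)
    haveI : Nonempty (Fin n) := ⟨⟨0, hn⟩⟩
    obtain ⟨i, hi⟩ := Finite.exists_max
      fun i => |coord (X : HyperPoint n) i - coord (Y : HyperPoint n) i|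
    have hi' : ∀ᶠ k in (Filter.hyperfilter ℕ : Filter ℕ),
        ∀ j, |X k j - Y k j| ≤ |X k i - Y k i| := by
      rw [Filter.eventually_all]
      intro j
      have := hi j
      simp only [eabs] at this
      exact Hyperreal.ofSeq_le_ofSeq.1 this
    refine aux_small O hO _ _ m (hxy i) ?_
    have e : |starFun f (X : HyperPoint n) - starFun f (Y : HyperPoint n)| =
        Hyperreal.ofSeq (fun k => |f (X k) - f (Y k)|) := Filter.Germ.abs_def _
    rw [e, eabs]
    have : Hyperreal.ofSeq (fun k => |f (X k) - f (Y k)|) ≤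
        Hyperreal.ofSeq (fun k => (m : ℝ) * |X k i - Y k i|) := by
      refine Hyperreal.ofSeq_le_ofSeq.2 ?_
      filter_upwards [hi', hXt ht, hYt ht] with k h1 h2 h3
      have h4 := hK.dist_le_mul _ h2 _ h3
      rw [Real.dist_eq] at h4
      have h5 : dist (X k) (Y k) ≤ |X k i - Y k i| :=
        (dist_pi_le_iff (abs_nonneg _)).2 fun j => by rw [Real.dist_eq]; exact h1 j
      exact h4.trans (mul_le_mul hm h5 dist_nonneg (Nat.cast_nonneg m))
    exact this
end

section
/- (Continuity of the induced function on the residue field, ε–δ form.) Let B = ∏ᵢ (aᵢ, bᵢ) ⊆ ℝⁿ be an open box, f : (Fin n → ℝ) → ℝ be continuously differentiable on B (ContDiffOn ℝ 1 f B), O a convex subring of ℝ* with o := {z ∈ ℝ* : z = 0 ∨ z⁻¹ ∉ O}, and let x be in the monad μ(B). Then for every ε ∈ O with z < ε for all z ∈ o, there exists δ ∈ O with z < δ for all z ∈ o, such that for all y ∈ μ(B): if |xᵢ − yᵢ| < δ for all i, then |*f(x) − *f(y)| < ε, where *f(x) := x.map f. -/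
/-- A real number belongs to every convex subring. -/
lemma real_mem_convex (O : Subring Hyperreal)
    (hconv : ∀ z w : Hyperreal, z ∈ O → |w| ≤ |z| → w ∈ O) (r : ℝ) :
    (Hyperreal.ofReal r) ∈ O := by
  obtain ⟨m, hm⟩ := exists_nat_ge |r|
  refine hconv (m : Hyperreal) _ (natCast_mem O m) ?_
  have h1 : ((|r| : ℝ) : Hyperreal) ≤ ((m : ℝ) : Hyperreal) := Hyperreal.coe_le_coe.2 hm
  have h2 : ((m : ℝ) : Hyperreal) = (m : Hyperreal) := map_natCast Hyperreal.coeRingHom m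
  rw [Hyperreal.coe_abs, h2] at h1
  exact h1.trans (le_abs_self _)

lemma coord_close (X : ℕ → ℝ) (hfin : IsFiniteHyper (Hyperreal.ofSeq X)) (d : ℝ) (hd : 0 < d) :
    ∀ᶠ k in (Filter.hyperfilter ℕ : Filter ℕ),
      |X k - Hyperreal.st (Hyperreal.ofSeq X)| < d := by
  have hni : ¬ Hyperreal.Infinite (Hyperreal.ofSeq X) := by
    intro h
    obtain ⟨m, hm⟩ := hfin
    have h3 := Hyperreal.infinite_iff_abs_lt_abs.1 h (m : ℝ)
    have h2 : ((m : ℝ) : Hyperreal) = (m : Hyperreal) := map_natCast Hyperreal.coeRingHom m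
    rw [h2] at h3
    exact absurd (lt_of_lt_of_le h3 hm) (not_lt.2 (le_abs_self _))
  have h := Hyperreal.isSt_ofSeq_iff_tendsto.1 (Hyperreal.isSt_st' hni)
  have h' := Metric.tendsto_nhds.1 h d hd
  simpa [Real.dist_eq] using h'

/-- continuity of the induced function, ε–δ form: for `f` which
is `C¹` on the open box `B`, `x` in the monad of `B`, and every `ε ∈ O` with
`ε > o`, there is `δ ∈ O` with `δ > o` such that for all `y` in the monad of
`B` with `|xᵢ - yᵢ| < δ` for all `i`, one has `|*f(x) - *f(y)| < ε`. -/
theorem stmt13 (n : ℕ) (a b : Fin n → ℝ) (hab : ∀ i, a i < b i)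
    (f : (Fin n → ℝ) → ℝ)
    (hf : ContDiffOn ℝ 1 f {v : Fin n → ℝ | ∀ i, v i ∈ Set.Ioo (a i) (b i)})
    (O : Subring Hyperreal)
    (hconv : ∀ z w : Hyperreal, z ∈ O → |w| ≤ |z| → w ∈ O)
    (o : Set Hyperreal) (ho : o = {z : Hyperreal | z = 0 ∨ z⁻¹ ∉ O})
    (x : HyperPoint n) (hx : InMonad a b x) :
    ∀ ε : Hyperreal, ε ∈ O → (∀ z ∈ o, z < ε) →
      ∃ δ : Hyperreal, δ ∈ O ∧ (∀ z ∈ o, z < δ) ∧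
        ∀ y : HyperPoint n, InMonad a b y →
          (∀ i : Fin n, |coord x i - coord y i| < δ) →
          |starFun f x - starFun f y| < ε := by
  intro ε hε hoε
  subst ho
  have hεpos : 0 < ε := hoε 0 (Or.inl rfl)
  set p : Fin n → ℝ := fun i => Hyperreal.st (coord x i) with hp
  have hopen : IsOpen {v : Fin n → ℝ | ∀ i, v i ∈ Set.Ioo (a i) (b i)} := by
    have : {v : Fin n → ℝ | ∀ i, v i ∈ Set.Ioo (a i) (b i)}
        = Set.pi Set.univ (fun i => Set.Ioo (a i) (b i)) := by
      ext v; simp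
    rw [this]
    exact isOpen_set_pi Set.finite_univ (fun i _ => isOpen_Ioo)
  have hfp : ContDiffAt ℝ 1 f p := hf.contDiffAt (hopen.mem_nhds (fun i => (hx i).2))
  obtain ⟨K, t, ht, hK⟩ := hfp.exists_lipschitzOnWith
  obtain ⟨r, hr, hrt⟩ := Metric.mem_nhds_iff.1 ht
  have hr2 : 0 < r / 2 := by positivity
  have hC : (0 : ℝ) < (K : ℝ) + 1 := by positivity
  set C : ℝ := (K : ℝ) + 1 with hCdef
  have hC1 : (1 : ℝ) ≤ C := by rw [hCdef]; linarith [K.2]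
  have hCs : (0 : Hyperreal) < (C : Hyperreal) := Hyperreal.coe_pos.2 hC
  have hC1s : (1 : Hyperreal) ≤ (C : Hyperreal) := by
    rw [← Hyperreal.coe_one]; exact Hyperreal.coe_le_coe.2 hC1
  have hrs : (0 : Hyperreal) < ((r / 2 : ℝ) : Hyperreal) := Hyperreal.coe_pos.2 hr2
  have hδpos : 0 < min (ε / (C : Hyperreal)) ((r / 2 : ℝ) : Hyperreal) :=
    lt_min (div_pos hεpos hCs) hrs
  refine ⟨min (ε / (C : Hyperreal)) ((r / 2 : ℝ) : Hyperreal), ?_, ?_, ?_⟩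
  · refine hconv ε _ hε ?_
    rw [abs_of_pos hδpos, abs_of_pos hεpos]
    exact (min_le_left _ _).trans (div_le_self hεpos.le hC1s)
  · intro z hz
    refine lt_min ?_ ?_
    · rw [lt_div_iff₀ hCs]
      refine hoε _ ?_
      rcases hz with rfl | hz
      · left; simp
      · right
        intro hmem
        apply hz
        have := O.mul_mem hmem (real_mem_convex O hconv C)
        rwa [mul_inv, mul_assoc, inv_mul_cancel₀ hCs.ne', mul_one] at this
    · rcases hz with rfl | hz
      · exact hrs
      · by_contra hle
        rw [not_lt] at hle
        apply hz
        have hzpos := lt_of_lt_of_le hrs hle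
        refine hconv _ _ (real_mem_convex O hconv (r / 2)⁻¹) ?_
        rw [Hyperreal.coe_inv, abs_of_pos (inv_pos.2 hzpos), abs_of_pos (inv_pos.2 hrs)]
        exact inv_anti₀ hrs hle
  · intro y _ hxy
    obtain ⟨X, rfl⟩ := Quot.exists_rep x
    obtain ⟨Y, rfl⟩ := Quot.exists_rep y
    obtain ⟨E, rfl⟩ := Hyperreal.ofSeq_surjective ε
    have hX : ∀ᶠ k in (Filter.hyperfilter ℕ : Filter ℕ), ∀ i, |X k i - p i| < r / 2 :=
      Filter.eventually_all.2 fun i => coord_close (fun k => X k i) (hx i).1 _ hr2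
    have hD : ∀ i, ∀ᶠ k in (Filter.hyperfilter ℕ : Filter ℕ),
        |X k i - Y k i| < min (E k / C) (r / 2) := by
      intro i
      have h := hxy i
      rw [lt_min_iff] at h
      have h1 : Hyperreal.ofSeq (fun k => |X k i - Y k i|) < Hyperreal.ofSeq (fun k => E k / C) := by
        have := h.1
        exact this
      have h2 : Hyperreal.ofSeq (fun k => |X k i - Y k i|) < Hyperreal.ofSeq (fun _ => r / 2) := by
        have := h.2
        exact this
      filter_upwards [Hyperreal.ofSeq_lt_ofSeq.1 h1, Hyperreal.ofSeq_lt_ofSeq.1 h2] with k a1 a2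
      exact lt_min a1 a2
    have hD' := Filter.eventually_all.2 hD
    have hE : ∀ᶠ k in (Filter.hyperfilter ℕ : Filter ℕ), 0 < E k :=
      (Hyperreal.ofSeq_lt_ofSeq (f := fun _ => 0) (g := E)).1 hεpos
    have key : Hyperreal.ofSeq (fun k => |f (X k) - f (Y k)|) < Hyperreal.ofSeq E := by
      rw [Hyperreal.ofSeq_lt_ofSeq]
      filter_upwards [hX, hD', hE] with k h1 h2 h3
      have hxb : X k ∈ Metric.ball p r := by
        rw [Metric.mem_ball, dist_pi_lt_iff hr]
        intro i
        rw [Real.dist_eq]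
        linarith [h1 i]
      have hyb : Y k ∈ Metric.ball p r := by
        rw [Metric.mem_ball, dist_pi_lt_iff hr]
        intro i
        have h5 := (h2 i).trans_le (min_le_right _ _)
        have h6 := abs_sub_le (Y k i) (X k i) (p i)
        rw [abs_sub_comm (Y k i) (X k i)] at h6
        rw [Real.dist_eq]
        linarith [h1 i]
      have hd : dist (X k) (Y k) < E k / C := by
        rw [dist_pi_lt_iff (div_pos h3 hC)]
        intro i
        rw [Real.dist_eq]
        exact (h2 i).trans_le (min_le_left _ _)
      have hl := hK.dist_le_mul _ (hrt hxb) _ (hrt hyb)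
      rw [Real.dist_eq] at hl
      rw [lt_div_iff₀ hC] at hd
      have : (K : ℝ) * dist (X k) (Y k) ≤ dist (X k) (Y k) * C := by
        rw [hCdef]; nlinarith [dist_nonneg (x := X k) (y := Y k)]
      linarith
    exact key
end

section
/- (Differentiability of the induced function, ε–δ form.) Let B = ∏ᵢ (aᵢ, bᵢ) ⊆ ℝⁿ be an open box, f : (Fin n → ℝ) → ℝ be twice continuously differentiable on B (ContDiffOn ℝ 2 f B), O a convex subring of ℝ* with o := {z ∈ ℝ* : z = 0 ∨ z⁻¹ ∉ O}, x ∈ μ(B), and i ∈ Fin n. For v ∈ B let ∂ᵢf(v) := fderiv ℝ f v (Pi.single i 1) denote the i-th partial derivative of f. Then for every infinitesimal ε ∈ ℝ* with z < ε for all z ∈ o, there exists δ ∈ O with z < δ for all z ∈ o, such that for every h ∈ ℝ* with 0 < |h| < δ: |(*f(x + h•eᵢ) − *f(x))/h − *(∂ᵢf)(x)| < ε, where eᵢ is the constant germ of the standard basis vector Pi.single i 1 : Fin n → ℝ, the point x + h•eᵢ is formed using the module structure of germs of Fin n → ℝ over germs of ℝ, *f(x) := x.map f, and *(∂ᵢf)(x)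 := x.map (fun v => fderiv ℝ f v (Pi.single i 1)). -/
/-- Reinterpret a hyperreal as a germ of real sequences (the identity map). -/
def Hyperreal.toGerm (x : Hyperreal) :
    Filter.Germ (Filter.hyperfilter ℕ : Filter ℕ) ℝ := x

theorem aux_real {n : ℕ} (f : (Fin n → ℝ) → ℝ) (p : Fin n → ℝ) (hf : ContDiffAt ℝ 2 f p)
    (i : Fin n) :
    ∃ r : ℝ, 0 < r ∧ ∃ C : ℕ, 1 ≤ C ∧ ∀ v : Fin n → ℝ, dist v p < r → ∀ h : ℝ, |h| < r → h ≠ 0 →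
      |(f (v + h • Pi.single i (1 : ℝ)) - f v) / h - fderiv ℝ f v (Pi.single i (1 : ℝ))|
        ≤ C * |h| := by
  have h1 : ContDiffAt ℝ 1 (fderiv ℝ f) p := hf.fderiv_right (by norm_num)
  obtain ⟨K, s, hs, hK⟩ := h1.exists_lipschitzOnWith
  have h2 : ∀ᶠ v in nhds p, DifferentiableAt ℝ f v := by
    filter_upwards [hf.eventually (by simp)] with v hv
    exact hv.differentiableAt (by norm_num)
  obtain ⟨R, hR, hball⟩ := Metric.mem_nhds_iff.1 (Filter.inter_mem hs h2)
  obtain ⟨C, hC⟩ := exists_nat_ge (K : ℝ)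
  refine ⟨R / 2, by positivity, C + 1, by omega, ?_⟩
  intro v hv h hh h0
  set e : Fin n → ℝ := Pi.single i (1 : ℝ) with he
  have hne : ‖e‖ = 1 := by simp [he, Pi.norm_single]
  have hsub : Metric.closedBall v |h| ⊆ Metric.ball p R := by
    intro w hw
    have := dist_triangle w v p
    simp only [Metric.mem_closedBall, Metric.mem_ball] at *
    linarith
  have hvm : v ∈ Metric.closedBall v |h| := Metric.mem_closedBall_self (abs_nonneg _)
  have hwm : v + h • e ∈ Metric.closedBall v |h| := by
    simp [Metric.mem_closedBall, dist_eq_norm, norm_smul, hne]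
  have key := (convex_closedBall v |h|).norm_image_sub_le_of_norm_hasFDerivWithin_le'
    (𝕜 := ℝ) (f := f) (f' := fderiv ℝ f) (φ := fderiv ℝ f v) (C := K * |h|)
    (fun w hw => ((hball (hsub hw)).2 : DifferentiableAt ℝ f w).hasFDerivAt.hasFDerivWithinAt)
    (fun w hw => by
      rw [← dist_eq_norm]
      refine (hK.dist_le_mul w (hball (hsub hw)).1 v (hball (hsub hvm)).1).trans ?_
      exact mul_le_mul_of_nonneg_left hw K.2) hvm hwm
  rw [add_sub_cancel_left, norm_smul, hne, mul_one, map_smul, Real.norm_eq_abs, Real.norm_eq_abs,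
    smul_eq_mul] at key
  have hpos : 0 < |h| := abs_pos.2 h0
  have e1 : (f (v + h • e) - f v) / h - fderiv ℝ f v e
      = (f (v + h • e) - f v - h * fderiv ℝ f v e) / h := by field_simp
  rw [e1, abs_div, div_le_iff₀ hpos]
  refine key.trans ?_
  gcongr
  push_cast
  linarith

theorem stmt14 (n : ℕ) (a b : Fin n → ℝ) (hab : ∀ i, a i < b i)
    (f : (Fin n → ℝ) → ℝ)
    (hf : ContDiffOn ℝ 2 f {v : Fin n → ℝ | ∀ i, v i ∈ Set.Ioo (a i) (b i)})
    (O : Subring Hyperreal)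
    (hconv : ∀ z w : Hyperreal, z ∈ O → |w| ≤ |z| → w ∈ O)
    (o : Set Hyperreal) (ho : o = {z : Hyperreal | z = 0 ∨ z⁻¹ ∉ O})
    (x : HyperPoint n) (hx : InMonad a b x) (i : Fin n) :
    ∀ ε : Hyperreal, Hyperreal.Infinitesimal ε → (∀ z ∈ o, z < ε) →
      ∃ δ : Hyperreal, δ ∈ O ∧ (∀ z ∈ o, z < δ) ∧
        ∀ h : Hyperreal, 0 < |h| → |h| < δ →
          |(starFun f
              (x + Hyperreal.toGerm h •
                (Filter.Germ.const (Pi.single i (1 : ℝ)) : HyperPoint n))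
            - starFun f x) / h
            - starFun (fun v => fderiv ℝ f v (Pi.single i (1 : ℝ))) x| < ε := by
  intro ε hε hoε
  set p : Fin n → ℝ := fun j => Hyperreal.st (coord x j) with hp
  have hopen : IsOpen {v : Fin n → ℝ | ∀ i, v i ∈ Set.Ioo (a i) (b i)} := by
    simp only [Set.setOf_forall]
    exact isOpen_iInter_of_finite fun j => isOpen_Ioo.preimage (continuous_apply j)
  have hpB : p ∈ {v : Fin n → ℝ | ∀ i, v i ∈ Set.Ioo (a i) (b i)} := fun j => (hx j).2
  obtain ⟨r, hr, C, hC, H⟩ := aux_real f p (hf.contDiffAt (hopen.mem_nhds hpB)) i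
  have hε0 : 0 < ε := hoε 0 (by simp [ho])
  have hCpos : (0 : Hyperreal) < (C : Hyperreal) := by exact_mod_cast hC
  have hC1 : (1 : Hyperreal) ≤ (C : Hyperreal) := by exact_mod_cast hC
  have hlt : ∀ s : ℝ, 0 < s → ε < (s : Hyperreal) := by
    intro s hs
    have := (hε s hs).2
    simpa using this
  have hδε : ε / C ≤ ε := div_le_self hε0.le hC1
  refine ⟨ε / C, ?_, ?_, ?_⟩
  · apply hconv 1 _ O.one_mem
    rw [abs_one, abs_of_pos (by positivity)]
    have := hlt 1 one_pos
    rw [Hyperreal.coe_one] at this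
    linarith
  · intro z hz
    rw [lt_div_iff₀ hCpos]
    apply hoε
    rw [ho] at hz ⊢
    rcases hz with hz | hz
    · left; simp [hz]
    · right
      intro hh
      apply hz
      have := O.mul_mem (natCast_mem O C) hh
      rwa [mul_inv, mul_comm z⁻¹, ← mul_assoc, mul_inv_cancel₀ hCpos.ne', one_mul] at this
  · intro h h0 hδ
    have hfin : |h| * C < ε := (lt_div_iff₀ hCpos).1 hδ
    refine lt_of_le_of_lt ?_ hfin
    have hhr : |h| < (r : Hyperreal) := (hδ.trans_le hδε).trans (hlt r hr)
    have hst : ∀ j, Hyperreal.IsSt (coord x j) (p j) := by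
      intro j
      apply Hyperreal.isSt_st'
      intro hinf
      obtain ⟨m, hm⟩ := (hx j).1
      have := (Hyperreal.infinite_iff_abs_lt_abs.1 hinf) m
      have h3 : ((|((m:ℝ):Hyperreal)|) : Hyperreal) = (m : Hyperreal) := by
        rw [← Hyperreal.coe_abs, abs_of_nonneg (by positivity)]; rfl
      rw [h3] at this
      exact absurd hm (not_le.2 this)
    induction x using Filter.Germ.inductionOn with | _ u => ?_
    obtain ⟨g, rfl⟩ := Hyperreal.ofSeq_surjective h
    have hu : ∀ j, Filter.Tendsto (fun k => u k j) (Filter.hyperfilter ℕ : Filter ℕ) (nhds (p j)) :=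
      fun j => Hyperreal.isSt_ofSeq_iff_tendsto.1 (hst j)
    have hu' : ∀ᶠ k in (Filter.hyperfilter ℕ : Filter ℕ), dist (u k) p < r :=
      (tendsto_pi_nhds.2 hu) (Metric.ball_mem_nhds p hr)
    have habs : ∀ q : ℕ → ℝ, |Hyperreal.ofSeq q| = Hyperreal.ofSeq (fun k => |q k|) := by
      intro q
      exact Filter.Germ.abs_def _
    have hg : ∀ᶠ k in (Filter.hyperfilter ℕ : Filter ℕ), |g k| < r := by
      rw [habs] at hhr
      exact Hyperreal.ofSeq_lt_ofSeq.1 hhr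
    have hg0 : ∀ᶠ k in (Filter.hyperfilter ℕ : Filter ℕ), 0 < |g k| := by
      rw [habs] at h0
      exact Hyperreal.ofSeq_lt_ofSeq.1 h0
    have e1 : (starFun f
              ((u : HyperPoint n) + Hyperreal.toGerm (Hyperreal.ofSeq g) •
                (Filter.Germ.const (Pi.single i (1 : ℝ)) : HyperPoint n))
            - starFun f (u : HyperPoint n)) / Hyperreal.ofSeq g
            - starFun (fun v => fderiv ℝ f v (Pi.single i (1 : ℝ))) (u : HyperPoint n)
        = Hyperreal.ofSeq (fun k => (f (u k + g k • Pi.single i (1 : ℝ)) - f (u k)) / g k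
            - fderiv ℝ f (u k) (Pi.single i (1 : ℝ))) := rfl
    have e2 : Hyperreal.ofSeq (fun k => |g k|) * (C : Hyperreal)
        = Hyperreal.ofSeq (fun k => |g k| * C) := rfl
    rw [e1, habs, habs, e2, Hyperreal.ofSeq_le_ofSeq]
    filter_upwards [hu', hg, hg0] with k k1 k2 k3
    rw [mul_comm]
    exact H _ k1 _ k2 (abs_pos.1 k3)
end
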